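/- arXiv:math/0505458 — 6 statements merged into one kernel-verified Lean document; each statement's English description precedes it below -/
import Mathlib

section
/- The extended tropical semiring 𝕋, equipped with the addition ⊕ and the multiplication ⊙, is a commutative semiring: ⊕ and ⊙ are associative and commutative, ⊙ distributes over ⊕, −∞ is an additive identity annihilating 𝕋 under ⊙, and 0 is a multiplicative identity. -/
/-- The extended tropical semiring `𝕋 = ℝ ∪ {−∞} ∪ ℝ^ν`:
`neginf` is `−∞`, `real a` is the real (tangible) element `a`,
and `ghost a` is the ghost element `a^ν`. -/
inductive T : Type where
  | neginf : T
  | real : ℝ → T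
  | ghost : ℝ → T

namespace T

/-- Tropical addition `⊕` on `𝕋`. -/
noncomputable def add : T → T → T
  | neginf, x => x
  | real a, neginf => real a
  | ghost a, neginf => ghost a
  | real a, real b => if a < b then real b else if b < a then real a else ghost a
  | real a, ghost b => if a ≤ b then ghost b else real a
  | ghost a, real b => if b ≤ a then ghost a else real b
  | ghost a, ghost b => if a < b then ghost b else ghost a

/-- Tropical multiplication `⊙` on `𝕋`. -/
noncomputable def mul : T → T → T
  | neginf, _ => neginf
  | real _, neginf => neginf
  | ghost _, neginf => neginf
  | real a, real b => real (a + b)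
  | real a, ghost b => ghost (a + b)
  | ghost a, real b => ghost (a + b)
  | ghost a, ghost b => ghost (a + b)

/-- The strict order `≺` on `𝕋`. -/
def lt : T → T → Prop
  | neginf, neginf => False
  | neginf, real _ => True
  | neginf, ghost _ => True
  | real _, neginf => False
  | ghost _, neginf => False
  | real a, real b => a < b
  | real a, ghost b => a ≤ b
  | ghost a, real b => a < b
  | ghost a, ghost b => a < b

/-- The order `⪯` on `𝕋`: `x ⪯ y` iff `x = y` or `x ≺ y`. -/
def le (x y : T) : Prop := x = y ∨ lt x y

/-- Membership in `ℝ̄^ν = ℝ^ν ∪ {−∞}` (the ghost elements together with `−∞`). -/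
def isGhost : T → Prop
  | neginf => True
  | real _ => False
  | ghost _ => True

/-- Membership in `ℝ` (the real, tangible elements). -/
def isReal : T → Prop
  | neginf => False
  | real _ => True
  | ghost _ => False

/-- The ghost map `ν : 𝕋 → ℝ̄^ν`. -/
def nu : T → T
  | neginf => neginf
  | real a => ghost a
  | ghost a => ghost a

/-- The projection `π : 𝕋 → ℝ ∪ {−∞}` onto the max-plus semiring `(ℝ ∪ {−∞}, max, +)`,
realized as `WithBot ℝ`. -/
def pi : T → WithBot ℝ
  | neginf => ⊥
  | real a => (a : WithBot ℝ)
  | ghost a => (a : WithBot ℝ)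

/-- The embedding `θ : (ℝ ∪ {−∞}, max, +) → 𝕋`, `a ↦ a^ν`, `−∞ ↦ −∞`. -/
def theta : WithBot ℝ → T :=
  fun x => WithBot.recBotCoe neginf (fun a => ghost a) x

/-- `pow x n` is the `n`-fold tropical product `x ⊙ x ⊙ ⋯ ⊙ x` (with `pow x 0 = 0`, the one). -/
noncomputable def pow (x : T) : ℕ → T
  | 0 => real 0
  | n + 1 => mul x (pow x n)

instance : Std.Commutative add := ⟨by
  intro x y
  cases x <;> cases y <;> simp only [add] <;> split_ifs <;>
    first | rfl | (exfalso; linarith) | (congr 1; linarith)⟩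

instance : Std.Associative add := ⟨by
  intro x y z
  cases x <;> cases y <;> cases z <;>
    simp only [add] <;>
    repeat' (first | split_ifs | simp only [add]) 
  all_goals first | rfl | (exfalso; linarith) | (congr 1; linarith)⟩

instance : Std.Commutative mul := ⟨by
  intro x y
  cases x <;> cases y <;> simp only [mul] <;> congr 1 <;> ring⟩

instance : Std.Associative mul := ⟨by
  intro x y z
  cases x <;> cases y <;> cases z <;> simp only [mul] <;> congr 1 <;> ring⟩

/-- Finite tropical sum `⊕` over a finite index set. -/
noncomputable def sumT {ι : Type*} (s : Finset ι) (f : ι → T) : T := s.fold add neginf f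

/-- Finite tropical product `⊙` over a finite index set. -/
noncomputable def prodT {ι : Type*} (s : Finset ι) (f : ι → T) : T := s.fold mul (real 0) f

/-- Tropical matrix multiplication over `𝕋`. -/
noncomputable def matMul {n : ℕ} (A B : Matrix (Fin n) (Fin n) T) : Matrix (Fin n) (Fin n) T :=
  fun i j => sumT Finset.univ fun k => mul (A i k) (B k j)

/-- The tropical determinant (permanent) `|A| = ⊕_{σ ∈ S_n} a_{1σ(1)} ⊙ ⋯ ⊙ a_{nσ(n)}`. -/
noncomputable def det {n : ℕ} (A : Matrix (Fin n) (Fin n) T) : T :=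
  sumT Finset.univ fun σ : Equiv.Perm (Fin n) => prodT Finset.univ fun i => A i (σ i)

/-- `A` is tropically regular if `|A| ∈ ℝ`. -/
def regular {n : ℕ} (A : Matrix (Fin n) (Fin n) T) : Prop := isReal (det A)

/-- `A` is tropically singular if `|A| ∈ ℝ̄^ν`. -/
def singular {n : ℕ} (A : Matrix (Fin n) (Fin n) T) : Prop := isGhost (det A)

/-- The minor `A_{ij}`: delete row `i` and column `j`. -/
noncomputable def minor {n : ℕ} (A : Matrix (Fin (n+1)) (Fin (n+1)) T) (i j : Fin (n+1)) :
    Matrix (Fin n) (Fin n) T :=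
  A.submatrix i.succAbove j.succAbove

/-- The adjoint matrix `Adj(A)`, the transpose of the matrix of minors' determinants. -/
noncomputable def adj {n : ℕ} (A : Matrix (Fin (n+1)) (Fin (n+1)) T) :
    Matrix (Fin (n+1)) (Fin (n+1)) T :=
  fun i j => det (minor A j i)

/-- The `⊙`-inverse `x^{-1}` (only meaningful away from `−∞`): `a ↦ −a`, `a^ν ↦ (−a)^ν`. -/
def dinv : T → T
  | neginf => neginf
  | real a => real (-a)
  | ghost a => ghost (-a)

/-- The pseudo inverse `A^∇ = Adj(A) ⊙ |A|^{-1}`. -/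
noncomputable def pinv {n : ℕ} (A : Matrix (Fin (n+1)) (Fin (n+1)) T) :
    Matrix (Fin (n+1)) (Fin (n+1)) T :=
  fun i j => mul (adj A i j) (dinv (det A))

/-- A pseudo unit matrix: tropically regular, `0` on the diagonal,
and ghosts (or `−∞`) off the diagonal. -/
def pseudoUnit {n : ℕ} (E : Matrix (Fin n) (Fin n) T) : Prop :=
  regular E ∧ (∀ i, E i i = real 0) ∧ ∀ i j, i ≠ j → isGhost (E i j)

/-- `A` is pseudo invertible if `A ⊙ B` and `B ⊙ A` are pseudo units for some `B`. -/
def pseudoInvertible {n : ℕ} (A : Matrix (Fin n) (Fin n) T) : Prop :=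
  ∃ B, pseudoUnit (matMul A B) ∧ pseudoUnit (matMul B A)

/-- The ray/point `P_x ⊆ ℝ ∪ {−∞}` assigned to `x ∈ 𝕋`:
`P_{−∞} = {−∞}`, `P_a = {a}`, `P_{a^ν} = [−∞, a]`. -/
def P : T → Set (WithBot ℝ)
  | neginf => {⊥}
  | real a => {(a : WithBot ℝ)}
  | ghost a => {t | t ≤ (a : WithBot ℝ)}

theorem mul_add_distrib (x y z : T) : mul x (add y z) = add (mul x y) (mul x z) := by
  cases x <;> cases y <;> cases z <;>
    simp only [add, mul, add_lt_add_iff_left, add_le_add_iff_left] <;> split_ifs <;>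
    first
    | rfl
    | (exfalso; linarith)
    | (simp only [ghost.injEq]; linarith)

theorem add_mul_distrib (x y z : T) : mul (add x y) z = add (mul x z) (mul y z) := by
  rw [Std.Commutative.comm (op := mul) (add x y) z, mul_add_distrib,
    Std.Commutative.comm (op := mul) z x, Std.Commutative.comm (op := mul) z y]

theorem add_neginf (x : T) : add x neginf = x := by
  cases x <;> rfl

theorem mul_neginf (x : T) : mul x neginf = neginf := by
  cases x <;> rfl

theorem real_zero_mul (x : T) : mul (real 0) x = x := by
  cases x <;> simp only [mul, zero_add]

theorem mul_real_zero (x : T) : mul x (real 0) = x := by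
  cases x <;> simp only [mul, add_zero]

end T

/-- `(𝕋, ⊕, ⊙)` is a commutative semiring: `⊕` and `⊙` are associative and
commutative, `⊙` distributes over `⊕`, `−∞` is an additive identity annihilating `𝕋`
under `⊙`, and `0` is a multiplicative identity. -/
theorem extended_tropical_comm_semiring :
    (∀ x y z : T, T.add (T.add x y) z = T.add x (T.add y z)) ∧
    (∀ x y : T, T.add x y = T.add y x) ∧
    (∀ x y z : T, T.mul (T.mul x y) z = T.mul x (T.mul y z)) ∧
    (∀ x y : T, T.mul x y = T.mul y x) ∧
    (∀ x y z : T, T.mul x (T.add y z) = T.add (T.mul x y) (T.mul x z)) ∧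
    (∀ x y z : T, T.mul (T.add x y) z = T.add (T.mul x z) (T.mul y z)) ∧
    (∀ x : T, T.add T.neginf x = x) ∧
    (∀ x : T, T.add x T.neginf = x) ∧
    (∀ x : T, T.mul T.neginf x = T.neginf) ∧
    (∀ x : T, T.mul x T.neginf = T.neginf) ∧
    (∀ x : T, T.mul (T.real 0) x = x) ∧
    (∀ x : T, T.mul x (T.real 0) = x) :=
  ⟨Std.Associative.assoc, Std.Commutative.comm, Std.Associative.assoc, Std.Commutative.comm,
    T.mul_add_distrib, T.add_mul_distrib, fun _ => rfl, T.add_neginf, fun _ => rfl,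
    T.mul_neginf, T.real_zero_mul, T.mul_real_zero⟩
end

section
/- Cauchy inequality: for every n ≥ 2 and all x_1, …, x_n ∈ 𝕋, one has x_1 ⊙ x_2 ⊙ ⋯ ⊙ x_n ⪯ x_1^n ⊕ x_2^n ⊕ ⋯ ⊕ x_n^n (where x ⪯ y means x = y or x ≺ y, and z^n is the n-fold ⊙-product). Moreover, if equality holds then ν(x_1) = ν(x_2) = ⋯ = ν(x_n) and at least one x_i lies in ℝ̄^ν. -/
namespace T

theorem pi_add (x y : T) : pi (add x y) = pi x ⊔ pi y := by
  cases x <;> cases y <;> simp only [add, pi, bot_sup_eq, sup_bot_eq] <;> split_ifs <;>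
    simp only [← WithBot.coe_sup, WithBot.coe_inj] <;> symm <;>
    first
      | (apply sup_eq_left.2; linarith)
      | (apply sup_eq_right.2; linarith)

theorem pi_mul (x y : T) : pi (mul x y) = pi x + pi y := by
  cases x <;> cases y <;> simp [mul, pi]

theorem pi_pow (x : T) (n : ℕ) : pi (pow x n) = n • pi x := by
  induction n with
  | zero => simp [pow, pi]
  | succ n ih => rw [pow, pi_mul, ih, succ_nsmul']

theorem pi_sumT {ι : Type*} (s : Finset ι) (f : ι → T) :
    pi (sumT s f) = s.sup fun i => pi (f i) := by
  classical
  induction s using Finset.induction_on with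
  | empty => rfl
  | insert i s hi ih =>
    rw [Finset.sup_insert, ← ih, ← pi_add, sumT, Finset.fold_insert hi, sumT]

theorem pi_prodT {ι : Type*} (s : Finset ι) (f : ι → T) :
    pi (prodT s f) = ∑ i ∈ s, pi (f i) := by
  classical
  induction s using Finset.induction_on with
  | empty => rfl
  | insert i s hi ih =>
    rw [Finset.sum_insert hi, ← ih, ← pi_mul, prodT, Finset.fold_insert hi, prodT]

theorem nu_eq_theta_pi (x : T) : nu x = theta (pi x) := by
  cases x <;> rfl

theorem isGhost_add_of_pi_eq {x y : T} (h : pi x = pi y) : isGhost (add x y) := by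
  cases x <;> cases y <;> simp_all [pi, add, isGhost]

theorem isGhost_or_of_isGhost_mul {x y : T} (h : isGhost (mul x y)) :
    isGhost x ∨ isGhost y := by
  cases x <;> cases y <;> simp_all [mul, isGhost]

theorem exists_isGhost_of_isGhost_prodT {ι : Type*} {s : Finset ι} {f : ι → T}
    (h : isGhost (prodT s f)) : ∃ i ∈ s, isGhost (f i) := by
  classical
  induction s using Finset.induction_on with
  | empty => exact h.elim
  | insert i s hi ih =>
    rw [prodT, Finset.fold_insert hi] at h
    rcases isGhost_or_of_isGhost_mul h with h | h
    · exact ⟨i, Finset.mem_insert_self i s, h⟩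
    · obtain ⟨j, hj, hg⟩ := ih h
      exact ⟨j, Finset.mem_insert_of_mem hj, hg⟩

theorem isGhost_sumT_of_pi_eq {ι : Type*} {s : Finset ι} (hs : 1 < s.card) {f : ι → T}
    {c : WithBot ℝ} (h : ∀ i ∈ s, pi (f i) = c) : isGhost (sumT s f) := by
  classical
  obtain ⟨i, hi, j, hj, hij⟩ := Finset.one_lt_card.1 hs
  rw [← Finset.insert_erase hi, sumT, Finset.fold_insert (Finset.notMem_erase i s)]
  apply isGhost_add_of_pi_eq
  change _ = pi (sumT _ _)
  rw [pi_sumT, h i hi,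
    Finset.sup_congr rfl fun k hk => h k (Finset.mem_of_mem_erase hk),
    Finset.sup_const ⟨j, Finset.mem_erase.2 ⟨hij.symm, hj⟩⟩]

theorem le_of_pi_le {x y : T} (h : pi x ≤ pi y) (hg : pi x = pi y → isGhost y) : le x y := by
  cases x <;> cases y <;> simp_all [pi, le, lt, isGhost, le_iff_lt_or_eq, or_comm]

end T

theorem WithBot.eq_of_sum_eq_card_nsmul {ι : Type*} {s : Finset ι} {f : ι → WithBot ℝ}
    {c : WithBot ℝ} (hf : ∀ i ∈ s, f i ≤ c) (h : ∑ i ∈ s, f i = s.card • c) :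
    ∀ i ∈ s, f i = c := by
  classical
  intro i hi
  by_contra hne
  have hlt : f i < c := lt_of_le_of_ne (hf i hi) hne
  lift c to ℝ using (bot_le.trans_lt hlt).ne'
  have hle : ∑ j ∈ s.erase i, f j ≤ (s.erase i).card • (c : WithBot ℝ) :=
    Finset.sum_le_card_nsmul _ _ _ fun j hj => hf j (Finset.mem_of_mem_erase hj)
  have hcard : s.card • (c : WithBot ℝ) = c + (s.erase i).card • (c : WithBot ℝ) := by
    rw [← succ_nsmul', Finset.card_erase_add_one hi]
  have hbot : (s.erase i).card • (c : WithBot ℝ) ≠ ⊥ := by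
    rw [← WithBot.coe_nsmul]
    exact WithBot.coe_ne_bot
  refine h.not_lt ?_
  rw [← Finset.add_sum_erase s f hi, hcard]
  calc f i + ∑ j ∈ s.erase i, f j ≤ f i + (s.erase i).card • (c : WithBot ℝ) := by gcongr
    _ < c + (s.erase i).card • (c : WithBot ℝ) := WithBot.add_lt_add_right hbot hlt

/-- the Cauchy inequality `x_1 ⊙ ⋯ ⊙ x_n ⪯ x_1^n ⊕ ⋯ ⊕ x_n^n` for `n ≥ 2`;
moreover equality forces all `ν(x_i)` to coincide and some `x_i` to lie in `ℝ̄^ν`. -/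
theorem tropical_cauchy_inequality (n : ℕ) (hn : 2 ≤ n) (x : Fin n → T) :
    T.le (T.prodT Finset.univ x) (T.sumT Finset.univ fun i => T.pow (x i) n) ∧
    (T.prodT Finset.univ x = T.sumT Finset.univ (fun i => T.pow (x i) n) →
      (∀ i j : Fin n, T.nu (x i) = T.nu (x j)) ∧ ∃ i : Fin n, T.isGhost (x i)) := by
  have : NeZero n := ⟨by omega⟩
  obtain ⟨m, hm⟩ := Finite.exists_max fun i => T.pi (x i)
  have hsum : T.pi (T.sumT Finset.univ fun i => T.pow (x i) n) = n • T.pi (x m) := by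
    simp only [T.pi_sumT, T.pi_pow]
    exact le_antisymm (Finset.sup_le fun i _ => nsmul_le_nsmul_right (hm i) n)
      (Finset.le_sup (f := fun i => n • T.pi (x i)) (Finset.mem_univ m))
  have hle : T.pi (T.prodT Finset.univ x) ≤ n • T.pi (x m) := by
    rw [T.pi_prodT]
    simpa using Finset.sum_le_card_nsmul Finset.univ (fun i => T.pi (x i)) _ fun i _ => hm i
  have heq (h : T.pi (T.prodT Finset.univ x) = n • T.pi (x m)) (i : Fin n) :
      T.pi (x i) = T.pi (x m) := by
    rw [T.pi_prodT] at h
    exact WithBot.eq_of_sum_eq_card_nsmul (s := Finset.univ) (fun i _ => hm i)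
      (by simpa using h) i (Finset.mem_univ i)
  have hghost (h : T.pi (T.prodT Finset.univ x) = n • T.pi (x m)) :
      T.isGhost (T.sumT Finset.univ fun i => T.pow (x i) n) :=
    T.isGhost_sumT_of_pi_eq (by rw [Finset.card_fin]; omega) (c := n • T.pi (x m))
      fun i _ => by rw [T.pi_pow, heq h i]
  refine ⟨T.le_of_pi_le (hsum ▸ hle) fun h => hghost (h.trans hsum), fun h => ?_⟩
  have hpi := (congrArg T.pi h).trans hsum
  refine ⟨fun i j => by rw [T.nu_eq_theta_pi, T.nu_eq_theta_pi, heq hpi i, heq hpi j], ?_⟩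
  obtain ⟨i, -, hi⟩ := T.exists_isGhost_of_isGhost_prodT (h ▸ hghost hpi)
  exact ⟨i, hi⟩
end

section
/- Let K be a commutative ring and Val : K → ℝ ∪ {−∞} a map satisfying Val(0) = −∞, Val(f·g) = Val(f) + Val(g) (with −∞ absorbing), Val(f+g) ≤ max{Val(f), Val(g)}, and Val(f+g) = max{Val(f), Val(g)} whenever Val(f) ≠ Val(g). Then for all f, g ∈ K and x, y ∈ 𝕋 with Val(f) ∈ P_x and Val(g) ∈ P_y, one has Val(f·g) ∈ P_{x⊙y} and Val(f+g) ∈ P_{x⊕y}. -/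
/-- The sets `P x` are compatible with tropical multiplication. -/
theorem T.add_mem_P_mul {x y : T} {u v : WithBot ℝ} (hu : u ∈ T.P x) (hv : v ∈ T.P y) :
    u + v ∈ T.P (T.mul x y) := by
  cases x <;> cases y <;>
    simp only [T.P, T.mul, Set.mem_singleton_iff, Set.mem_ofPred_eq, WithBot.coe_add] at hu hv ⊢ <;>
    first
    | simp [hu, hv]; done
    | exact add_le_add hu hv
    | exact add_le_add (le_of_eq hu) hv
    | exact add_le_add hu (le_of_eq hv)

/-- The sets `P x` are compatible with tropical addition: `w` stands for the value of a sum of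
two elements of values `u` and `v`. -/
theorem T.mem_P_add {x y : T} {u v w : WithBot ℝ} (hu : u ∈ T.P x) (hv : v ∈ T.P y)
    (hw : w ≤ max u v) (hne : u ≠ v → w = max u v) : w ∈ T.P (T.add x y) := by
  have hlt : u < v → w = v := fun h => (hne h.ne).trans (max_eq_right h.le)
  have hgt : v < u → w = u := fun h => (hne h.ne').trans (max_eq_left h.le)
  cases x with
  | neginf =>
    obtain rfl : u = ⊥ := hu
    rcases eq_bot_or_bot_lt v with rfl | h
    · obtain rfl : w = ⊥ := by simpa using hw
      exact hv
    · rw [hlt h]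
      exact hv
  | real a =>
    obtain rfl : u = a := hu
    cases y with
    | neginf =>
      obtain rfl : v = ⊥ := hv
      exact hgt (WithBot.bot_lt_coe a)
    | real b =>
      obtain rfl : v = b := hv
      simp only [T.add]
      split_ifs with hab hba
      · exact hlt (WithBot.coe_lt_coe.2 hab)
      · exact hgt (WithBot.coe_lt_coe.2 hba)
      · exact hw.trans (max_le le_rfl (WithBot.coe_le_coe.2 (not_lt.1 hab)))
    | ghost b =>
      have hv : v ≤ b := hv
      simp only [T.add]
      split_ifs with hab
      · exact hw.trans (max_le (WithBot.coe_le_coe.2 hab) hv)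
      · exact hgt (hv.trans_lt (WithBot.coe_lt_coe.2 (not_le.1 hab)))
  | ghost a =>
    have hu : u ≤ a := hu
    cases y with
    | neginf =>
      obtain rfl : v = ⊥ := hv
      exact hw.trans (max_le hu bot_le)
    | real b =>
      obtain rfl : v = b := hv
      simp only [T.add]
      split_ifs with hba
      · exact hw.trans (max_le hu (WithBot.coe_le_coe.2 hba))
      · exact hlt (hu.trans_lt (WithBot.coe_lt_coe.2 (not_le.1 hba)))
    | ghost b =>
      have hv : v ≤ b := hv
      simp only [T.add]
      split_ifs with hab
      · exact hw.trans (max_le (hu.trans (WithBot.coe_le_coe.2 hab.le)) hv)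
      · exact hw.trans (max_le hu (hv.trans (WithBot.coe_le_coe.2 (not_lt.1 hab))))

/-- for a commutative ring `K` with a non-archimedean valuation
`Val : K → ℝ ∪ {−∞}`, the relation `Val(f) ∈ P_x` is homomorphic:
`Val(f·g) ∈ P_{x⊙y}` and `Val(f+g) ∈ P_{x⊕y}`. -/
theorem val_homomorphic_relation {K : Type*} [CommRing K] (Val : K → WithBot ℝ)
    (h0 : Val 0 = ⊥)
    (hmul : ∀ f g : K, Val (f * g) = Val f + Val g)
    (hadd : ∀ f g : K, Val (f + g) ≤ max (Val f) (Val g))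
    (hadd' : ∀ f g : K, Val f ≠ Val g → Val (f + g) = max (Val f) (Val g))
    (f g : K) (x y : T) (hf : Val f ∈ T.P x) (hg : Val g ∈ T.P y) :
    Val (f * g) ∈ T.P (T.mul x y) ∧ Val (f + g) ∈ T.P (T.add x y) := by
  rw [hmul]
  exact ⟨T.add_mem_P_mul hf hg, T.mem_P_add hf hg (hadd f g) (hadd' f g)⟩
end

section
/- Let n ≥ 2 and A ∈ M_n(𝕋). If A has two identical rows, or two identical columns, then A is tropically singular, i.e. |A| ∈ ℝ̄^ν. -/
namespace T

theorem isGhost_add_self (x : T) : isGhost (add x x) := by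
  cases x <;> simp [add, isGhost]

theorem isGhost_add {x y : T} (hx : isGhost x) (hy : isGhost y) : isGhost (add x y) := by
  cases x <;> cases y <;> simp only [add, isGhost] at * <;> split_ifs <;> trivial

/-- A tropical sum whose terms are paired off by a fixed-point-free involution is a ghost. -/
theorem isGhost_sumT_of_involution {ι : Type*} [DecidableEq ι] (f : ι → T) (g : ι → ι)
    (hg : ∀ x, g (g x) = x) (hne : ∀ x, g x ≠ x) (hf : ∀ x, f (g x) = f x) (s : Finset ι)
    (hs : ∀ x ∈ s, g x ∈ s) : isGhost (sumT s f) := by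
  induction s using Finset.strongInduction with
  | H s ih =>
    rcases s.eq_empty_or_nonempty with rfl | ⟨x, hx⟩
    · simp [sumT, isGhost]
    · have hgx : g x ∈ s.erase x := Finset.mem_erase.2 ⟨hne x, hs x hx⟩
      have hrest : isGhost (sumT ((s.erase x).erase (g x)) f) := by
        refine ih _ ((Finset.erase_subset _ _).trans_ssubset (Finset.erase_ssubset hx)) ?_
        intro y hy
        simp only [Finset.mem_erase] at hy ⊢
        obtain ⟨hy₁, hy₂, hy₃⟩ := hy
        refine ⟨fun h => hy₂ ?_, fun h => hy₁ ?_, hs y hy₃⟩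
        · rw [← hg y, h, hg]
        · rw [← hg y, h]
      have hsum : sumT s f = add (add (f x) (f x)) (sumT ((s.erase x).erase (g x)) f) := by
        unfold sumT
        conv_lhs => rw [← Finset.insert_erase hx, ← Finset.insert_erase hgx]
        rw [Finset.insert_erase hgx, Finset.fold_insert (Finset.notMem_erase x s),
          ← Finset.insert_erase hgx, Finset.fold_insert (Finset.notMem_erase _ _), hf,
          Finset.insert_erase hgx, Std.Associative.assoc (op := add)]
      rw [hsum]
      exact isGhost_add (isGhost_add_self _) hrest

theorem prodT_univ_comp_equiv {ι : Type*} [Fintype ι] (e : Equiv.Perm ι) (f : ι → T) :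
    prodT Finset.univ (fun k => f (e k)) = prodT Finset.univ f := by
  unfold prodT
  conv_rhs => rw [← Finset.map_univ_equiv e, Finset.fold_map]
  rfl

end T

/-- a matrix with two identical rows, or two identical columns,
is tropically singular (`|A| ∈ ℝ̄^ν`). -/
theorem det_identical_rows_or_cols_singular {n : ℕ} (A : Matrix (Fin n) (Fin n) T)
    (i j : Fin n) (hij : i ≠ j)
    (h : (∀ k, A i k = A j k) ∨ (∀ k, A k i = A k j)) :
    T.isGhost (T.det A) := by
  have hswap : Equiv.swap i j ≠ 1 := by
    simpa [Equiv.swap_eq_one_iff] using hij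
  rcases h with h | h
  · refine T.isGhost_sumT_of_involution _ (fun σ => σ * Equiv.swap i j) (fun σ => ?_)
      (fun σ hσ => hswap (mul_eq_left.1 hσ)) (fun σ => ?_) _ (fun _ _ => Finset.mem_univ _)
    · simp [mul_assoc]
    · rw [← T.prodT_univ_comp_equiv (Equiv.swap i j) fun k => A k (σ k)]
      congr 1
      funext k
      rw [Equiv.Perm.mul_apply]
      rcases eq_or_ne k i with rfl | hi
      · rw [Equiv.swap_apply_left, h]
      rcases eq_or_ne k j with rfl | hj
      · rw [Equiv.swap_apply_right, h]
      rw [Equiv.swap_apply_of_ne_of_ne hi hj]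
  · refine T.isGhost_sumT_of_involution _ (fun σ => Equiv.swap i j * σ) (fun σ => ?_)
      (fun σ hσ => hswap (mul_eq_right.1 hσ)) (fun σ => ?_) _ (fun _ _ => Finset.mem_univ _)
    · simp [← mul_assoc]
    · congr 1
      funext k
      rw [Equiv.Perm.mul_apply]
      rcases eq_or_ne (σ k) i with hi | hi
      · rw [hi, Equiv.swap_apply_left, h]
      rcases eq_or_ne (σ k) j with hj | hj
      · rw [hj, Equiv.swap_apply_right, h]
      rw [Equiv.swap_apply_of_ne_of_ne hi hj]
end

section
/- If A, B ∈ M_n(𝕋) are tropically regular matrices and their product A ⊙ B is also tropically regular, then |A ⊙ B| = |A| ⊙ |B|. -/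
namespace Matrix

open Equiv

variable {ι R : Type*} [Fintype ι] [DecidableEq ι] [CommSemiring R]

/-- If `f` is not injective, the sum over all permutations is twice the sum over the even ones. -/
theorem sum_perm_prod_eq_double_of_not_injective (A : Matrix ι ι R) (b : ι → R) {f : ι → ι}
    (hf : ¬ Function.Injective f) :
    ∑ σ : Perm ι, ∏ i, A (σ i) (f i) * b i =
      (∑ σ : Perm ι with Perm.sign σ = 1, ∏ i, A (σ i) (f i) * b i) +
        ∑ σ : Perm ι with Perm.sign σ = 1, ∏ i, A (σ i) (f i) * b i := by
  obtain ⟨p, q, hpq, hne⟩ : ∃ p q, f p = f q ∧ p ≠ q := by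
    simpa [Function.Injective] using hf
  have invol : ∀ σ : Perm ι, ∏ i, A (σ i) (f i) * b i =
      ∏ i, A ((σ * Equiv.swap p q) i) (f i) * b i := fun σ => by
    rw [Finset.prod_mul_distrib, Finset.prod_mul_distrib]
    congr 1
    exact Fintype.prod_equiv (Equiv.swap p q) _ _ (by simp [apply_swap_eq_self hpq])
  rw [← Finset.sum_filter_add_sum_filter_not _ fun σ : Perm ι => Perm.sign σ = 1]
  congr 1
  refine Finset.sum_nbij' (· * Equiv.swap p q) (· * Equiv.swap p q) ?_ ?_ ?_ ?_
    fun σ _ => invol σ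
  · intro σ hσ
    have h : Perm.sign σ = -1 :=
      (Int.units_eq_one_or _).resolve_left (Finset.mem_filter.1 hσ).2
    simp [Perm.sign_mul, Perm.sign_swap hne, h]
  · intro σ hσ
    have h : Perm.sign σ = 1 := (Finset.mem_filter.1 hσ).2
    simp [Perm.sign_mul, Perm.sign_swap hne, h]
  · intro σ _
    simp [mul_assoc]
  · intro σ _
    simp [mul_assoc]

/-- The permanent is multiplicative up to a term of the form `x + x`. -/
theorem exists_permanent_mul_eq (A B : Matrix ι ι R) :
    ∃ x : R, (A * B).permanent = A.permanent * B.permanent + (x + x) := by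
  have expand : (A * B).permanent =
      ∑ f : ι → ι, ∑ σ : Perm ι, ∏ i, A (σ i) (f i) * B (f i) i := by
    simp only [permanent, mul_apply, Finset.prod_univ_sum, Fintype.piFinset_univ]
    exact Finset.sum_comm
  have bij : ∑ f : ι → ι with Function.Injective f,
      ∑ σ : Perm ι, ∏ i, A (σ i) (f i) * B (f i) i = A.permanent * B.permanent := by
    calc
      _ = ∑ τ : Perm ι, ∑ σ : Perm ι, ∏ i, A (σ i) (τ i) * B (τ i) i :=
        Finset.sum_bij
          (fun f h => Equiv.ofBijective f
            (Finite.injective_iff_bijective.1 (Finset.mem_filter.1 h).2))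
          (fun _ _ => Finset.mem_univ _) (fun _ _ _ _ h => by injection h)
          (fun τ _ => ⟨τ, Finset.mem_filter.2 ⟨Finset.mem_univ _, τ.injective⟩,
            coe_fn_injective rfl⟩) fun _ _ => rfl
      _ = ∑ τ : Perm ι, A.permanent * ∏ i, B (τ i) i := by
        refine Finset.sum_congr rfl fun τ _ => ?_
        simp only [Finset.prod_mul_distrib, ← Finset.sum_mul]
        congr 1
        exact A.permanent_permute_rows τ
      _ = A.permanent * B.permanent := by rw [← Finset.mul_sum]; rfl
  refine ⟨∑ f : ι → ι with ¬ Function.Injective f,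
    ∑ σ : Perm ι with Perm.sign σ = 1, ∏ i, A (σ i) (f i) * B (f i) i, ?_⟩
  rw [expand, ← Finset.sum_filter_add_sum_filter_not _ Function.Injective, bij,
    ← Finset.sum_add_distrib]
  congr 1
  exact Finset.sum_congr rfl fun f hf =>
    sum_perm_prod_eq_double_of_not_injective A (fun i => B (f i) i) (Finset.mem_filter.1 hf).2

end Matrix

namespace T

noncomputable instance : Add T := ⟨add⟩

noncomputable instance : Mul T := ⟨mul⟩

instance : Zero T := ⟨neginf⟩

noncomputable instance : One T := ⟨real 0⟩

/-- The extended tropical semiring is a commutative semiring. -/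
noncomputable instance : CommSemiring T where
  nsmul := nsmulRec
  add_assoc := Std.Associative.assoc (op := add)
  add_comm := Std.Commutative.comm (op := add)
  mul_assoc := Std.Associative.assoc (op := mul)
  mul_comm := Std.Commutative.comm (op := mul)
  zero_add _ := rfl
  add_zero x := by cases x <;> rfl
  zero_mul _ := rfl
  mul_zero x := by cases x <;> rfl
  one_mul x := by
    change mul (real 0) x = x
    cases x <;> simp [mul]
  mul_one x := by
    change mul x (real 0) = x
    cases x <;> simp [mul]
  left_distrib x y z := by
    change mul x (add y z) = add (mul x y) (mul x z)
    cases x <;> cases y <;> cases z <;> simp only [add, mul, add_lt_add_iff_left,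
      add_le_add_iff_left] <;> split_ifs <;>
      first | rfl | (exfalso; linarith) | (simp only; congr 1; linarith)
  right_distrib x y z := by
    change mul (add x y) z = add (mul x z) (mul y z)
    cases x <;> cases y <;> cases z <;> simp only [add, mul, add_lt_add_iff_right,
      add_le_add_iff_right] <;> split_ifs <;>
      first | rfl | (exfalso; linarith) | (simp only; congr 1; linarith)

theorem sumT_eq_sum {ι : Type*} (s : Finset ι) (f : ι → T) : sumT s f = ∑ i ∈ s, f i := by
  rfl

theorem prodT_eq_prod {ι : Type*} (s : Finset ι) (f : ι → T) : prodT s f = ∏ i ∈ s, f i := by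
  rfl

theorem matMul_eq_mul {n : ℕ} (A B : Matrix (Fin n) (Fin n) T) : matMul A B = A * B := by
  ext i j
  exact sumT_eq_sum _ _

theorem det_eq_permanent {n : ℕ} (A : Matrix (Fin n) (Fin n) T) : det A = A.permanent := by
  simp only [det, sumT_eq_sum, prodT_eq_prod]
  rw [← Matrix.permanent_transpose]
  rfl

/-- Every `y ⊕ y` is ghost or `−∞`, so it does not contribute to a real sum. -/
theorem eq_of_isReal_add_double {x y : T} (h : isReal (x + (y + y))) : x + (y + y) = x := by
  change isReal (add x (add y y)) at h
  change add x (add y y) = x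
  cases x <;> cases y <;> simp only [add, lt_irrefl, if_false] at h ⊢ <;>
    (try split_ifs at h ⊢) <;> first | rfl | exact h.elim

end T

/-- if `A`, `B` and `A ⊙ B` are all tropically regular,
then `|A ⊙ B| = |A| ⊙ |B|`. -/
theorem det_matMul_of_regular {n : ℕ} (A B : Matrix (Fin n) (Fin n) T)
    (hA : T.regular A) (hB : T.regular B) (hAB : T.regular (T.matMul A B)) :
    T.det (T.matMul A B) = T.mul (T.det A) (T.det B) := by
  obtain ⟨x, hx⟩ := Matrix.exists_permanent_mul_eq A B
  rw [T.regular, T.matMul_eq_mul, T.det_eq_permanent, hx] at hAB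
  rw [T.matMul_eq_mul, T.det_eq_permanent, T.det_eq_permanent, T.det_eq_permanent, hx]
  exact T.eq_of_isReal_add_double hAB
end

section
/- If A, B ∈ M_n(𝕋) and at least one of A or B is tropically singular, then the product A ⊙ B is tropically singular, i.e. |A ⊙ B| ∈ ℝ̄^ν. -/
namespace Matrix

open Finset

variable {m R : Type*} [Fintype m] [DecidableEq m] [CommSemiring R]

/-- The permanent of a matrix with two equal rows is twice an element. -/
theorem exists_permanent_eq_add_self_of_row_eq (M : Matrix m m R) {p q : m} (hpq : p ≠ q)
    (h : M p = M q) : ∃ c, M.permanent = c + c := by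
  rw [← permanent_transpose, permanent]
  refine ⟨∑ σ : Equiv.Perm m with Equiv.Perm.sign σ = 1, ∏ i, Mᵀ (σ i) i, ?_⟩
  rw [← sum_filter_add_sum_filter_not univ (fun σ : Equiv.Perm m => Equiv.Perm.sign σ = 1)]
  congr 1
  refine sum_equiv (Equiv.mulRight (Equiv.swap p q)) (fun σ => ?_) fun σ _ => ?_
  · rcases Int.units_eq_one_or (Equiv.Perm.sign σ) with hσ | hσ <;>
      simp [hσ, Equiv.Perm.sign_swap hpq]
  · refine Fintype.prod_equiv (Equiv.swap p q) _ _ fun i => ?_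
    have hM : M (Equiv.swap p q i) = M i := by
      by_cases hp : i = p
      · simp [hp, h]
      by_cases hq : i = q
      · simp [hq, h]
      rw [Equiv.swap_apply_of_ne_of_ne hp hq]
    simp [hM]

/-- If an ideal contains all `x + x`, then it contains `permanent (A * B)` as soon as it
contains `permanent B`. -/
theorem permanent_mul_mem_of_right (I : Ideal R) (hI : ∀ x, x + x ∈ I) (A B : Matrix m m R)
    (hB : B.permanent ∈ I) : (A * B).permanent ∈ I := by
  have key : (A * B).permanent =
      ∑ f : m → m, (∏ i, A i (f i)) * (B.submatrix f id).permanent := by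
    rw [← permanent_transpose]
    simp only [← permanent_transpose (B.submatrix _ id)]
    simp only [permanent, transpose_apply, mul_apply, prod_univ_sum, Fintype.piFinset_univ,
      mul_sum, submatrix_apply, id, prod_mul_distrib]
    exact sum_comm
  rw [key]
  refine sum_mem fun f _ => I.mul_mem_left _ ?_
  by_cases hf : Function.Injective f
  · have := permanent_permute_cols (Equiv.ofBijective f (Finite.injective_iff_bijective.mp hf)) B
    exact this ▸ hB
  · simp only [Function.Injective, not_forall] at hf
    obtain ⟨p, q, hfpq, hpq⟩ := hf
    obtain ⟨c, hc⟩ := exists_permanent_eq_add_self_of_row_eq (B.submatrix f id) hpq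
      (by ext j; simp [hfpq])
    exact hc ▸ hI c

/-- If an ideal contains all `x + x`, then it contains `permanent (A * B)` as soon as it
contains `permanent A`. -/
theorem permanent_mul_mem_of_left (I : Ideal R) (hI : ∀ x, x + x ∈ I) (A B : Matrix m m R)
    (hA : A.permanent ∈ I) : (A * B).permanent ∈ I := by
  rw [← permanent_transpose, transpose_mul]
  exact permanent_mul_mem_of_right I hI _ _ (by rwa [permanent_transpose])

end Matrix

namespace T

noncomputable instance inst_s11 : CommSemiring T where
  nsmul := nsmulRec
  npow := npowRec
  add_assoc := Std.Associative.assoc (op := add)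
  add_comm := Std.Commutative.comm (op := add)
  zero_add _ := rfl
  add_zero x := by cases x <;> rfl
  mul_assoc := Std.Associative.assoc (op := mul)
  mul_comm := Std.Commutative.comm (op := mul)
  zero_mul _ := rfl
  mul_zero x := by cases x <;> rfl
  one_mul x := by
    change mul (real 0) x = x
    cases x <;> simp [mul]
  mul_one x := by
    change mul x (real 0) = x
    cases x <;> simp [mul]
  left_distrib := mul_add_distrib
  right_distrib x y z := by
    change mul (add x y) z = add (mul x z) (mul y z)
    simp only [Std.Commutative.comm (op := mul) _ z, mul_add_distrib]

/-- The ideal `ℝ̄^ν` of ghost elements, together with `−∞`. -/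
def ghostIdeal : Ideal T where
  carrier := {x | isGhost x}
  add_mem' {x y} hx hy := by
    change isGhost (add x y)
    cases x <;> cases y <;> simp_all [isGhost, add] <;> split_ifs <;> trivial
  zero_mem' := trivial
  smul_mem' x y hy := by
    change isGhost (mul x y)
    cases x <;> cases y <;> simp_all [isGhost, mul]

theorem add_self_mem_ghostIdeal (x : T) : x + x ∈ ghostIdeal := by
  change isGhost (add x x)
  cases x <;> simp [add, isGhost]

theorem singular_iff_permanent_mem {n : ℕ} (A : Matrix (Fin n) (Fin n) T) :
    singular A ↔ A.permanent ∈ ghostIdeal := by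
  rw [← det_eq_permanent]; rfl

end T

/-- if `A` or `B` is tropically singular, then so is `A ⊙ B`. -/
theorem matMul_singular_of_singular {n : ℕ} (A B : Matrix (Fin n) (Fin n) T)
    (h : T.singular A ∨ T.singular B) :
    T.singular (T.matMul A B) := by
  rw [T.matMul_eq_mul]
  simp only [T.singular_iff_permanent_mem] at h ⊢
  rcases h with h | h
  · exact Matrix.permanent_mul_mem_of_left _ T.add_self_mem_ghostIdeal A B h
  · exact Matrix.permanent_mul_mem_of_right _ T.add_self_mem_ghostIdeal A B h
end
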